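/- Let W be a real m×n matrix whose i-th row is ψ_i ∈ ℝⁿ, let M be a real n×m matrix with M·W = I_n whose j-th column is ψ†_j ∈ ℝⁿ, and let δ ∈ {0,1}^m with D_δ the m×m diagonal matrix with diagonal entries δ. Let ε be a random vector in ℝⁿ with independent coordinates each distributed N(0,σ²), σ > 0. Then the noise-propagation term of the risk satisfies E‖M D_δ W ε‖² = σ² Σ_{i=1}^m Σ_{j=1}^m δ_i δ_j ⟨ψ†_i, ψ†_j⟩ ⟨ψ_i, ψ_j⟩. -/

import Mathlib

open MeasureTheory ProbabilityTheory Matrix Finset NNReal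

lemma aux_memLp (n : ℕ) (v : ℝ≥0) (a : Fin n) :
    MemLp (fun ε : Fin n → ℝ => ε a) 2 (Measure.pi fun _ : Fin n => gaussianReal 0 v) := by
  have h : MemLp (id : ℝ → ℝ) 2 (gaussianReal 0 v) := by
    simpa using memLp_id_gaussianReal (μ := 0) (v := v) 2
  exact h.comp_measurePreserving
    (measurePreserving_eval (fun _ : Fin n => gaussianReal 0 v) a)

lemma aux_integrable (n : ℕ) (v : ℝ≥0) (a b : Fin n) :
    Integrable (fun ε : Fin n → ℝ => ε a * ε b)
      (Measure.pi fun _ : Fin n => gaussianReal 0 v) :=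
  (aux_memLp n v a).integrable_mul (aux_memLp n v b)

lemma aux_moment (n : ℕ) (v : ℝ≥0) (a b : Fin n) :
    ∫ ε : Fin n → ℝ, ε a * ε b ∂(Measure.pi fun _ : Fin n => gaussianReal 0 v)
      = if a = b then (v : ℝ) else 0 := by
  have hmean : ∀ c : Fin n,
      ∫ ε : Fin n → ℝ, ε c ∂(Measure.pi fun _ : Fin n => gaussianReal 0 v) = 0 := by
    intro c
    have := integral_comp_eval (μ := fun _ : Fin n => gaussianReal 0 v) (i := c)
      (f := fun x : ℝ => x) (by fun_prop)
    rw [this]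
    simp
  split_ifs with hab
  · subst hab
    have := integral_comp_eval (μ := fun _ : Fin n => gaussianReal 0 v) (i := a)
      (f := fun x : ℝ => x * x) (by fun_prop)
    rw [this]
    have h2 := variance_of_integral_eq_zero (μ := gaussianReal 0 v) (X := fun x : ℝ => x)
      (by fun_prop) (by simp)
    rw [variance_fun_id_gaussianReal] at h2
    rw [h2]
    simp [sq]
  · have hi := iIndepFun_pi (μ := fun _ : Fin n => gaussianReal 0 v)
      (X := fun _ : Fin n => (id : ℝ → ℝ)) (fun _ => by fun_prop)
    have := (hi.indepFun hab).integral_fun_mul_eq_mul_integral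
      (aux_memLp n v a).1 (aux_memLp n v b).1
    simp only [id] at this
    rw [this, hmean, zero_mul]

/-- For an analysis operator `W` (rows `ψ_i`), a left inverse `M` (columns
`ψ†_j`, `M * W = 1`), a selection pattern `δ ∈ {0,1}^m`, and i.i.d. `N(0,σ²)` noise `ε`,
the noise-propagation term satisfies
`E‖M D_δ W ε‖² = σ² ∑_i ∑_j δ_i δ_j ⟨ψ†_i, ψ†_j⟩ ⟨ψ_i, ψ_j⟩`. -/
theorem overcomplete_paper_stmt4
    (m n : ℕ) (W : Matrix (Fin m) (Fin n) ℝ) (M : Matrix (Fin n) (Fin m) ℝ)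
    (hMW : M * W = 1)
    (δ : Fin m → ℝ) (hδ : ∀ i, δ i = 0 ∨ δ i = 1)
    (σ : ℝ≥0) (hσ : 0 < σ) :
    (∫ ε : Fin n → ℝ,
        ‖(EuclideanSpace.equiv (Fin n) ℝ).symm
            (M.mulVec ((Matrix.diagonal δ).mulVec (W.mulVec ε)))‖ ^ 2
        ∂(Measure.pi fun _ : Fin n => gaussianReal 0 (σ ^ 2)))
      = (σ : ℝ) ^ 2 * ∑ i, ∑ j, δ i * δ j
          * (∑ k, M k i * M k j) * (∑ k, W i k * W j k) := by
  have hA : ∀ ε : Fin n → ℝ,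
      ‖(EuclideanSpace.equiv (Fin n) ℝ).symm
            (M.mulVec ((Matrix.diagonal δ).mulVec (W.mulVec ε)))‖ ^ 2
      = ∑ k, ∑ a, ∑ b, ((∑ i, M k i * δ i * W i a) * (∑ j, M k j * δ j * W j b))
          * (ε a * ε b) := by
    intro ε
    rw [EuclideanSpace.norm_sq_eq]
    refine Finset.sum_congr rfl fun k _ => ?_
    have hk : ((EuclideanSpace.equiv (Fin n) ℝ).symm
            (M.mulVec ((Matrix.diagonal δ).mulVec (W.mulVec ε)))) k
        = ∑ a, (∑ i, M k i * δ i * W i a) * ε a := by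
      change (M.mulVec ((Matrix.diagonal δ).mulVec (W.mulVec ε))) k = _
      have hd : (Matrix.diagonal δ).mulVec (W.mulVec ε)
          = fun i => δ i * ∑ a, W i a * ε a := by
        funext i
        rw [Matrix.mulVec_diagonal]
        rfl
      rw [hd]
      change ∑ i, M k i * (δ i * ∑ a, W i a * ε a) = _
      simp only [Finset.mul_sum, Finset.sum_mul]
      rw [Finset.sum_comm]
      refine Finset.sum_congr rfl fun a _ => Finset.sum_congr rfl fun i _ => ?_
      ring
    rw [hk, Real.norm_eq_abs, sq_abs, sq, Finset.sum_mul_sum]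
    refine Finset.sum_congr rfl fun a _ => Finset.sum_congr rfl fun b _ => ?_
    ring
  simp_rw [hA]
  have hint : ∀ (c : ℝ) (a b : Fin n), Integrable (fun ε : Fin n → ℝ => c * (ε a * ε b))
      (Measure.pi fun _ : Fin n => gaussianReal 0 (σ ^ 2)) :=
    fun c a b => (aux_integrable n _ a b).const_mul c
  rw [integral_finsetSum _ fun k _ => integrable_finsetSum _ fun a _ =>
    integrable_finsetSum _ fun b _ => hint _ a b]
  have h1 : ∀ k : Fin n, ∫ ε : Fin n → ℝ, ∑ a, ∑ b,
      ((∑ i, M k i * δ i * W i a) * (∑ j, M k j * δ j * W j b)) * (ε a * ε b)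
        ∂(Measure.pi fun _ : Fin n => gaussianReal 0 (σ ^ 2))
      = ∑ a, ((∑ i, M k i * δ i * W i a) * (∑ j, M k j * δ j * W j a)) * (σ : ℝ) ^ 2 := by
    intro k
    rw [integral_finsetSum _ fun a _ => integrable_finsetSum _ fun b _ => hint _ a b]
    refine Finset.sum_congr rfl fun a _ => ?_
    rw [integral_finsetSum _ fun b _ => hint _ a b]
    simp only [integral_const_mul, aux_moment]
    simp
  simp_rw [h1, Finset.sum_mul_sum, ← Finset.sum_mul]
  rw [mul_comm]
  congr 1
  have h2 : ∀ i j : Fin m, δ i * δ j * (∑ k, M k i * M k j) * (∑ k, W i k * W j k)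
      = ∑ k, ∑ a, M k i * δ i * W i a * (M k j * δ j * W j a) := by
    intro i j
    rw [mul_assoc, Finset.sum_mul_sum, Finset.mul_sum]
    refine Finset.sum_congr rfl fun k _ => ?_
    rw [Finset.mul_sum]
    refine Finset.sum_congr rfl fun a _ => ?_
    ring
  simp_rw [h2]
  calc _ = ∑ k, ∑ i, ∑ j, ∑ a, M k i * δ i * W i a * (M k j * δ j * W j a) := by
        refine Finset.sum_congr rfl fun k _ => ?_
        rw [Finset.sum_comm]
        exact Finset.sum_congr rfl fun i _ => Finset.sum_comm
    _ = _ := by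
        rw [Finset.sum_comm]
        exact Finset.sum_congr rfl fun i _ => Finset.sum_comm
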